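/- Let ρ satisfy the moment hypotheses and the decay hypothesis, and for each integer N ≥ σ let Φ_N be the N-fold convolution of ρ_{h_N} with itself, where h_N = √(σ/N). Then Φ_N converges uniformly on ℝ to the Gaussian density x ↦ (2πσγ)^{-1/2} exp(−x²/(2σγ)); that is, sup_{x∈ℝ} |Φ_N(x) − (2πσγ)^{-1/2} exp(−x²/(2σγ))| → 0 as N → ∞. -/

import Mathlib

open MeasureTheory Filter Real Topology

/-- The Fourier transform `ρ̂(t) = ∫ e^{-itx} ρ(x) dx` of a real-valued function. -/
noncomputable def FT (ρ : ℝ → ℝ) (t : ℝ) : ℂ :=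
  ∫ x : ℝ, Complex.exp (-Complex.I * t * x) * (ρ x : ℂ)

/-- `nConv f N` is the `N`-fold convolution `f ∗ ⋯ ∗ f` (`N` factors); junk value `0` for `N = 0`. -/
noncomputable def nConv (f : ℝ → ℝ) : ℕ → ℝ → ℝ
  | 0 => fun _ => 0
  | 1 => f
  | (n + 2) => fun x => ∫ z : ℝ, nConv f (n + 1) (x - z) * f z

open scoped FourierTransform SchwartzMap Convolution ContDiff

theorem continuous_fourier_of_integrable {f : ℝ → ℂ} (hf : Integrable f) : Continuous (𝓕 f) :=
  VectorFourier.fourierIntegral_continuous continuous_fourierChar (by exact continuous_inner) hf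

theorem norm_fourier_le_integral_norm (f : ℝ → ℂ) (w : ℝ) : ‖𝓕 f w‖ ≤ ∫ x, ‖f x‖ :=
  VectorFourier.norm_fourierIntegral_le_integral_norm _ _ _ _ _

theorem integral_fourier_mul_eq_of_integrable {f g : ℝ → ℂ} (hf : Integrable f)
    (hg : Integrable g) : ∫ x, 𝓕 f x * g x = ∫ x, f x * 𝓕 g x := by
  simpa using! VectorFourier.integral_bilin_fourierIntegral_eq_flip (ContinuousLinearMap.mul ℂ ℂ)
    (L := innerₗ ℝ) continuous_fourierChar continuous_inner hf hg

theorem continuous_fourierInv_of_integrable {f : ℝ → ℂ} (hf : Integrable f) :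
    Continuous (𝓕⁻ f) := by
  have : 𝓕⁻ f = fun x => 𝓕 f (-x) := by
    ext x; exact Real.fourierInv_eq_fourier_neg f x
  rw [this]
  exact (continuous_fourier_of_integrable hf).comp continuous_neg

theorem norm_fourierInv_le_integral_norm (f : ℝ → ℂ) (x : ℝ) : ‖𝓕⁻ f x‖ ≤ ∫ w, ‖f w‖ := by
  rw [Real.fourierInv_eq_fourier_neg]
  exact norm_fourier_le_integral_norm f _

/-- Fourier inversion almost everywhere for an integrable function with integrable transform. -/
theorem ae_eq_fourierInv_fourier {f : ℝ → ℂ} (hf : Integrable f) (hf' : Integrable (𝓕 f)) :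
    f =ᵐ[volume] 𝓕⁻ (𝓕 f) := by
  refine ae_eq_of_integral_contDiff_smul_eq hf.locallyIntegrable
    (continuous_fourierInv_of_integrable hf').locallyIntegrable fun g hg hgc => ?_
  have hgc' : HasCompactSupport (fun x => (g x : ℂ)) := hgc.comp_left (g := Complex.ofReal) rfl
  let ψ : 𝓢(ℝ, ℂ) := hgc'.toSchwartzMap (Complex.ofRealCLM.contDiff.comp hg)
  have hψ (x : ℝ) : ψ x = g x := rfl
  obtain ⟨φ, hφ⟩ : ∃ φ : 𝓢(ℝ, ℂ), 𝓕 φ = ψ := ⟨𝓕⁻ ψ, by simp⟩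
  have h₁ (x : ℝ) : (g x : ℂ) = 𝓕 (φ : ℝ → ℂ) x := by
    rw [← hψ, ← hφ, SchwartzMap.fourier_coe]
  have h₂ (x : ℝ) : (g (-x) : ℂ) = (𝓕⁻ φ) x := by
    rw [h₁, SchwartzMap.fourierInv_coe, Real.fourierInv_eq_fourier_neg]
  have e₁ : ∫ x, g x • f x = ∫ x, φ x * 𝓕 f x := by
    simp_rw [Complex.real_smul, h₁]
    exact integral_fourier_mul_eq_of_integrable φ.integrable hf
  have e₂ : ∫ x, g x • 𝓕⁻ (𝓕 f) x = ∫ x, φ x * 𝓕 f x := by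
    rw [← integral_neg_eq_self]
    simp_rw [Complex.real_smul, h₂, Real.fourierInv_eq_fourier_neg, neg_neg]
    rw [← integral_fourier_mul_eq_of_integrable (𝓕⁻ φ).integrable hf', ← SchwartzMap.fourier_coe]
    simp
  rw [e₁, e₂]

theorem ofReal_nConv_eq_convolution (f : ℝ → ℝ) (n : ℕ) :
    (fun x => (nConv f (n + 2) x : ℂ)) =
      (fun x => (f x : ℂ)) ⋆[ContinuousLinearMap.mul ℂ ℂ] fun x => (nConv f (n + 1) x : ℂ) := by
  ext x
  simp only [nConv, convolution_def, ContinuousLinearMap.mul_apply', ← integral_complex_ofReal]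
  congr with z
  push_cast
  ring

theorem integrable_nConv {f : ℝ → ℝ} (hf : Integrable f) (n : ℕ) :
    Integrable (fun x => (nConv f (n + 1) x : ℂ)) := by
  induction n with
  | zero => exact hf.ofReal
  | succ n ih =>
    rw [ofReal_nConv_eq_convolution]
    exact Integrable.integrable_convolution _ hf.ofReal ih

theorem fourier_nConv {f : ℝ → ℝ} (hf : Integrable f) (n : ℕ) (w : ℝ) :
    𝓕 (fun x => (nConv f (n + 1) x : ℂ)) w = 𝓕 (fun x => (f x : ℂ)) w ^ (n + 1) := by
  induction n with
  | zero => simp [nConv]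
  | succ n ih =>
    rw [pow_succ', ← ih, ofReal_nConv_eq_convolution]
    exact Real.fourier_mul_convolution_eq hf.ofReal (integrable_nConv hf n) w

theorem continuous_nConv {f : ℝ → ℝ} (hf : Integrable f) (n : ℕ)
    (hn : Integrable fun w => 𝓕 (fun x => (f x : ℂ)) w ^ (n + 1)) :
    Continuous (fun x => (nConv f (n + 2) x : ℂ)) := by
  have hF : 𝓕 (fun x => (nConv f (n + 1) x : ℂ)) = fun w => 𝓕 (fun x => (f x : ℂ)) w ^ (n + 1) :=
    funext (fourier_nConv hf n)
  have hae := ae_eq_fourierInv_fourier (integrable_nConv hf n) (hF ▸ hn)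
  rw [hF] at hae
  rw [ofReal_nConv_eq_convolution, convolution_congr _ (ae_eq_refl _) hae]
  refine BddAbove.continuous_convolution_right_of_integrable _ ⟨?_, ?_⟩ hf.ofReal
    (continuous_fourierInv_of_integrable hn)
  · exact ∫ w, ‖𝓕 (fun x => (f x : ℂ)) w ^ (n + 1)‖
  rintro _ ⟨x, rfl⟩
  exact norm_fourierInv_le_integral_norm _ x

/-- Fourier inversion for the iterated convolution, valid at every point. -/
theorem nConv_eq_fourierInv {f : ℝ → ℝ} (hf : Integrable f) (n : ℕ)
    (hn : Integrable fun w => 𝓕 (fun x => (f x : ℂ)) w ^ (n + 1))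
    (hn' : Integrable fun w => 𝓕 (fun x => (f x : ℂ)) w ^ (n + 2)) (x : ℝ) :
    (nConv f (n + 2) x : ℂ) = 𝓕⁻ (fun w => 𝓕 (fun x => (f x : ℂ)) w ^ (n + 2)) x := by
  have hF : 𝓕 (fun x => (nConv f (n + 2) x : ℂ)) = fun w => 𝓕 (fun x => (f x : ℂ)) w ^ (n + 2) :=
    funext (fourier_nConv hf (n + 1))
  rw [← hF]
  exact (congrFun ((continuous_nConv hf n hn).fourierInv_fourier_eq (integrable_nConv hf (n + 1))
    (hF ▸ hn')) x).symm

theorem norm_charFun_lt_one {μ : Measure ℝ} [IsProbabilityMeasure μ] (hμ : μ ≪ volume) {s : ℝ}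
    (hs : s ≠ 0) : ‖charFun μ s‖ < 1 := by
  by_contra! h
  set z := charFun μ s with hz
  set θ := Complex.arg z
  have hint : Integrable (fun x : ℝ => Complex.exp ((s * x - θ : ℝ) * Complex.I)) μ := by
    refine Integrable.of_bound (by fun_prop) 1 (ae_of_all _ fun x => ?_)
    rw [Complex.norm_exp_ofReal_mul_I]
  have hI : ∫ x, Complex.exp ((s * x - θ : ℝ) * Complex.I) ∂μ = ‖z‖ := by
    have (x : ℝ) : Complex.exp ((s * x - θ : ℝ) * Complex.I)
        = Complex.exp (s * x * Complex.I) * Complex.exp (-(θ * Complex.I)) := by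
      rw [← Complex.exp_add]; congr 1; push_cast; ring
    simp_rw [this]
    rw [integral_mul_const, ← charFun_apply_real, ← hz]
    conv_lhs => rw [← Complex.norm_mul_exp_arg_mul_I z]
    rw [mul_assoc, ← Complex.exp_add]
    simp [θ]
  have hcos : ∫ x, Real.cos (s * x - θ) ∂μ = ‖z‖ := by
    have := congrArg Complex.re hI
    rw [← Complex.reCLM_apply, ← Complex.reCLM.integral_comp_comm hint] at this
    simpa only [Complex.reCLM_apply, Complex.exp_ofReal_mul_I_re, Complex.ofReal_re] using this
  have hcint : Integrable (fun x : ℝ => Real.cos (s * x - θ)) μ :=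
    Integrable.of_bound (by fun_prop) 1 (ae_of_all _ fun x => Real.abs_cos_le_one _)
  have hzero : ∫ x, (1 - Real.cos (s * x - θ)) ∂μ = 0 := by
    refine le_antisymm ?_ (integral_nonneg fun x => by simp [Real.cos_le_one])
    rw [integral_sub (integrable_const _) hcint, hcos]
    simpa using h
  have hsub : Integrable (fun x : ℝ => 1 - Real.cos (s * x - θ)) μ :=
    (integrable_const _).sub hcint
  rw [integral_eq_zero_iff_of_nonneg (fun x => by simp [Real.cos_le_one]) hsub] at hzero
  have hcount : {x : ℝ | Real.cos (s * x - θ) = 1}.Countable := by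
    refine (Set.countable_range fun k : ℤ => (k * (2 * π) + θ) / s).mono fun x hx => ?_
    obtain ⟨k, hk⟩ := (Real.cos_eq_one_iff _).1 hx
    exact ⟨k, by simp only [hk]; field_simp; ring⟩
  have hnull := hμ (hcount.measure_zero volume)
  have hfalse : ∀ᵐ x ∂μ, False := by
    filter_upwards [hzero, measure_eq_zero_iff_ae_notMem.1 hnull] with x h₁ h₂
    exact h₂ (sub_eq_zero.1 h₁).symm
  simpa using hfalse.exists

theorem taylor_charFun_centered {μ : Measure ℝ} [IsProbabilityMeasure μ] {γ : ℝ}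
    (hint : MemLp id 2 μ) (hmean : ∫ x, x ∂μ = 0) (hvar : ∫ x, x ^ 2 ∂μ = γ) :
    (fun t : ℝ => charFun μ t - (1 - γ * t ^ 2 / 2)) =o[𝓝 0] fun t => t ^ 2 := by
  have h (t : ℝ) : taylorWithinEval (charFun μ) 2 Set.univ 0 t = 1 - γ * t ^ 2 / 2 := by
    simpa [hmean, hvar] using
      taylorWithinEval_charFun_two_zero (X := id) (P := μ) aemeasurable_id (by simpa using hint) t
  simp_rw [← h]
  convert! taylor_isLittleO_univ (contDiff_charFun hint)
  simp

theorem tendsto_pow_of_taylor {φ : ℝ → ℂ} {γ : ℝ}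
    (hφ : (fun t : ℝ => φ t - (1 - γ * t ^ 2 / 2)) =o[𝓝 0] fun t => t ^ 2)
    {σ : ℝ} (hσ : 0 ≤ σ) (t : ℝ) :
    Tendsto (fun N : ℕ => φ (√(σ / N) * t) ^ N) atTop
      (𝓝 (Complex.exp (-(σ * γ * t ^ 2 / 2 : ℝ)))) := by
  apply Complex.tendsto_pow_exp_of_isLittleO_sub_add_div
  have hlim : Tendsto (fun N : ℕ => √(σ / N) * t) atTop (𝓝 0) := by
    have := (Real.continuous_sqrt.tendsto 0).comp (tendsto_const_div_atTop_nhds_zero_nat σ)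
    simpa using this.mul_const t
  have hsq (N : ℕ) : (√(σ / N) * t) ^ 2 = σ * t ^ 2 * (1 / N) := by
    rw [mul_pow, Real.sq_sqrt (by positivity)]; ring
  have h := hφ.comp_tendsto hlim
  simp only [Function.comp_def, ← Complex.ofReal_pow, hsq] at h
  have h' := h.trans_isBigO
    (Asymptotics.isBigO_const_mul_self (σ * t ^ 2) (fun N : ℕ => 1 / (N : ℝ)) atTop)
  refine (h'.congr_left fun N => ?_).trans_isBigO (Asymptotics.isBigO_of_le _ fun N => by simp)
  push_cast
  ring

/-- A single power of `φ` has a quadratically decaying bound valid on the whole line. -/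
theorem exists_pow_le_inv_one_add_sq {φ : ℝ → ℂ} {γ α C T : ℝ} (hcont : Continuous φ)
    (hlt : ∀ s ≠ 0, ‖φ s‖ < 1) (hγ : 0 < γ)
    (hφ : (fun t : ℝ => φ t - (1 - γ * t ^ 2 / 2)) =o[𝓝 0] fun t => t ^ 2)
    (hα : 0 < α) (hdecay : ∀ s, T < |s| → ‖φ s‖ ≤ C * |s| ^ (-α)) :
    ∃ m : ℕ, 0 < m ∧ ∃ c > 0, ∀ s, ‖φ s‖ ^ m ≤ (1 + c * s ^ 2)⁻¹ := by
  have hexp {c s : ℝ} (hc : 0 < c) (h : ‖φ s‖ ≤ 1 - c * s ^ 2) : ‖φ s‖ ≤ (1 + c * s ^ 2)⁻¹ := by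
    rw [← one_div, le_div_iff₀ (by positivity)]
    nlinarith [mul_le_mul_of_nonneg_right h (by positivity : 0 ≤ 1 + c * s ^ 2),
      sq_nonneg (c * s ^ 2)]
  obtain ⟨δ, hδ, hnear⟩ : ∃ δ > 0, ∀ s, |s| < δ → ‖φ s‖ ≤ 1 - γ / 4 * s ^ 2 := by
    have h₁ := hφ.def (show 0 < γ / 4 by positivity)
    have h₂ : ∀ᶠ s : ℝ in 𝓝 0, γ * s ^ 2 / 2 < 1 := by
      have : Tendsto (fun s : ℝ => γ * s ^ 2 / 2) (𝓝 0) (𝓝 (γ * 0 ^ 2 / 2)) :=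
        Continuous.tendsto (by fun_prop) 0
      exact this.eventually_lt_const (by simp)
    obtain ⟨δ, hδ, h⟩ := Metric.eventually_nhds_iff.1 (h₁.and h₂)
    refine ⟨δ, hδ, fun s hs => ?_⟩
    obtain ⟨h₁, h₂⟩ := h (by simpa using hs)
    have h₃ : ‖(1 - γ * s ^ 2 / 2 : ℂ)‖ = 1 - γ * s ^ 2 / 2 := by
      rw [show (1 - γ * s ^ 2 / 2 : ℂ) = ((1 - γ * s ^ 2 / 2 : ℝ) : ℂ) by push_cast; ring,
        Complex.norm_real, Real.norm_of_nonneg (by linarith)]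
    have h₄ := norm_add_le (φ s - (1 - γ * s ^ 2 / 2)) (1 - γ * s ^ 2 / 2 : ℂ)
    rw [sub_add_cancel, h₃] at h₄
    rw [Real.norm_of_nonneg (sq_nonneg s)] at h₁
    linarith
  obtain ⟨m, hm⟩ := exists_nat_gt (3 / α)
  have hm₀ : 0 < m := by
    have : (0 : ℝ) < m := lt_trans (by positivity) hm
    exact_mod_cast this
  rw [div_lt_iff₀ hα] at hm
  obtain ⟨R, hRT, hR1, hRC⟩ : ∃ R : ℝ, T < R ∧ 1 ≤ R ∧ 2 * |C| ^ m ≤ R :=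
    ⟨max (T + 1) (max 1 (2 * |C| ^ m)), by simp, by simp, by simp⟩
  have hfar (s : ℝ) (hs : R ≤ |s|) : ‖φ s‖ ^ m ≤ (1 + s ^ 2)⁻¹ := by
    have hs1 : 1 ≤ |s| := hR1.trans hs
    have hs0 : 0 < |s| := by linarith
    calc ‖φ s‖ ^ m ≤ (|C| * |s| ^ (-α)) ^ m := by
          gcongr
          exact (hdecay s (hRT.trans_le hs)).trans (by gcongr; exact le_abs_self C)
      _ = |C| ^ m * |s| ^ (-(m * α)) := by
          rw [mul_pow, ← Real.rpow_natCast (|s| ^ (-α)), ← Real.rpow_mul hs0.le]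
          ring_nf
      _ ≤ |C| ^ m * |s| ^ (-(3 : ℝ)) := by
          gcongr
      _ ≤ (1 + s ^ 2)⁻¹ := by
          rw [Real.rpow_neg hs0.le, ← div_eq_mul_inv, ← one_div,
            show (3 : ℝ) = (3 : ℕ) by norm_num, Real.rpow_natCast,
            div_le_div_iff₀ (by positivity) (by positivity), ← sq_abs s]
          have : |C| ^ m * (1 + |s| ^ 2) ≤ |C| ^ m * (2 * |s| ^ 2) := by
            gcongr; nlinarith
          nlinarith [sq_nonneg |s|]
  obtain ⟨d, hd, hmid⟩ : ∃ d > 0, ∀ s, δ ≤ |s| → |s| ≤ R → ‖φ s‖ ≤ 1 - d * s ^ 2 := by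
    have hne {s : ℝ} (hs : δ ≤ |s|) : s ≠ 0 := abs_pos.1 (hδ.trans_le hs)
    have hK : IsCompact {s : ℝ | δ ≤ |s| ∧ |s| ≤ R} := by
      refine (isCompact_Icc (a := -R) (b := R)).of_isClosed_subset ?_ fun s hs => abs_le.1 hs.2
      exact (isClosed_le continuous_const continuous_abs).inter
        (isClosed_le continuous_abs continuous_const)
    obtain ⟨d, hd, h⟩ := hK.exists_forall_le' (f := fun s => (1 - ‖φ s‖) / s ^ 2) (a := 0)
      (ContinuousOn.div (by fun_prop) (by fun_prop) fun s hs => pow_ne_zero 2 (hne hs.1))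
      fun s hs => div_pos (sub_pos.2 (hlt s (hne hs.1))) (by have := hne hs.1; positivity)
    refine ⟨d, hd, fun s h₁ h₂ => ?_⟩
    have := h s ⟨h₁, h₂⟩
    have hs := hne h₁
    rw [le_div_iff₀ (by positivity)] at this
    linarith
  refine ⟨m, hm₀, min (γ / 4) (min d 1), by positivity, fun s => ?_⟩
  have hle : ‖φ s‖ ≤ 1 := by
    rcases eq_or_ne s 0 with rfl | hs
    · simpa using hnear 0 (by simpa using hδ)
    · exact (hlt s hs).le
  have hpow : ‖φ s‖ ^ m ≤ ‖φ s‖ := pow_le_of_le_one (norm_nonneg _) hle hm₀.ne'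
  have hmono {c : ℝ} (hc : min (γ / 4) (min d 1) ≤ c) :
      (1 + c * s ^ 2)⁻¹ ≤ (1 + min (γ / 4) (min d 1) * s ^ 2)⁻¹ := by
    gcongr
  rcases lt_or_ge |s| δ with h | h
  · exact (hpow.trans (hexp (by positivity) (hnear s h))).trans (hmono (min_le_left _ _))
  rcases le_or_gt |s| R with h' | h'
  · exact (hpow.trans (hexp hd (hmid s h h'))).trans (hmono (by simp))
  · exact (by simpa using hfar s h'.le : ‖φ s‖ ^ m ≤ (1 + 1 * s ^ 2)⁻¹).trans (hmono (by simp))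

theorem pow_scaled_le_inv_one_add_sq {φ : ℝ → ℂ} (hφ : ∀ s, ‖φ s‖ ≤ 1) {m : ℕ}
    (hm : 0 < m) {c : ℝ} (hc : 0 < c) (hb : ∀ s, ‖φ s‖ ^ m ≤ (1 + c * s ^ 2)⁻¹) {σ : ℝ}
    (hσ : 0 ≤ σ) {N : ℕ} (hN : m ≤ N) (t : ℝ) :
    ‖φ (√(σ / N) * t)‖ ^ N ≤ (1 + c * σ / (2 * m) * t ^ 2)⁻¹ := by
  set s := √(σ / N) * t with hs
  have hs2 : s ^ 2 = σ / N * t ^ 2 := by rw [hs, mul_pow, Real.sq_sqrt (by positivity)]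
  have hN0 : (0 : ℝ) < N := by exact_mod_cast hm.trans_le hN
  have hm0 : (0 : ℝ) < m := by exact_mod_cast hm
  have hk : N ≤ 2 * m * (N / m) := by
    have h₁ := Nat.div_add_mod N m
    have h₂ := Nat.mod_lt N hm
    have h₃ : m * 1 ≤ m * (N / m) := Nat.mul_le_mul_left m (Nat.div_pos hN hm)
    linarith
  have hk' : (N : ℝ) ≤ 2 * m * (N / m : ℕ) := by exact_mod_cast hk
  calc ‖φ s‖ ^ N ≤ ‖φ s‖ ^ (m * (N / m)) :=
        pow_le_pow_of_le_one (norm_nonneg _) (hφ s) (Nat.mul_div_le N m)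
    _ = (‖φ s‖ ^ m) ^ (N / m) := pow_mul _ _ _
    _ ≤ ((1 + c * s ^ 2)⁻¹) ^ (N / m) := by gcongr; exact hb s
    _ = ((1 + c * s ^ 2) ^ (N / m))⁻¹ := inv_pow _ _
    _ ≤ (1 + (N / m : ℕ) * (c * s ^ 2))⁻¹ := by
        gcongr
        exact one_add_mul_le_pow (by nlinarith [mul_nonneg hc.le (sq_nonneg s)]) _
    _ ≤ (1 + c * σ / (2 * m) * t ^ 2)⁻¹ := by
        rw [hs2]
        gcongr 1
        gcongr 1
        calc c * σ / (2 * m) * t ^ 2 = N * (c * σ * t ^ 2 / (2 * m * N)) := by field_simp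
          _ ≤ (2 * m * (N / m : ℕ)) * (c * σ * t ^ 2 / (2 * m * N)) := by gcongr
          _ = (N / m : ℕ) * (c * (σ / N * t ^ 2)) := by field_simp

theorem norm_fourierInv_sub_le {F G : ℝ → ℂ} (hF : Integrable F) (hG : Integrable G) (x : ℝ) :
    ‖𝓕⁻ F x - 𝓕⁻ G x‖ ≤ ∫ w, ‖F w - G w‖ := by
  have h {H : ℝ → ℂ} (hH : Integrable H) : Integrable fun w => 𝐞 (inner ℝ w x) • H w := by
    simpa using (Real.fourierIntegral_convergent_iff (-x)).2 hH
  rw [Real.fourierInv_eq, Real.fourierInv_eq, ← integral_sub (h hF) (h hG)]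
  refine (norm_integral_le_integral_norm _).trans_eq ?_
  simp_rw [← smul_sub, Circle.norm_smul]

theorem integral_withDensity_ofReal {E : Type*} [NormedAddCommGroup E] [NormedSpace ℝ E]
    {ρ : ℝ → ℝ} (hInt : Integrable ρ) (hpos : ∀ᵐ x : ℝ, 0 ≤ ρ x) (g : ℝ → E) :
    ∫ x, g x ∂(volume.withDensity fun x => ENNReal.ofReal (ρ x)) = ∫ x, ρ x • g x := by
  rw [integral_withDensity_eq_integral_toReal_smul₀ hInt.1.aemeasurable.ennreal_ofReal (by simp)]
  refine integral_congr_ae ?_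
  filter_upwards [hpos] with x hx
  rw [ENNReal.toReal_ofReal hx]

theorem FT_eq_charFun {ρ : ℝ → ℝ} (hInt : Integrable ρ) (hpos : ∀ᵐ x : ℝ, 0 ≤ ρ x) (t : ℝ) :
    FT ρ t = charFun (volume.withDensity fun x => ENNReal.ofReal (ρ x)) (-t) := by
  rw [charFun_apply_real, integral_withDensity_ofReal hInt hpos, FT]
  refine integral_congr_ae (ae_of_all _ fun x => ?_)
  simp only [Complex.real_smul]
  rw [mul_comm]
  congr 2
  push_cast
  ring

theorem fourier_scaled_eq_FT (ρ : ℝ → ℝ) {h : ℝ} (hh : 0 < h) (w : ℝ) :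
    𝓕 (fun u => ((h⁻¹ * ρ (h⁻¹ * u) : ℝ) : ℂ)) w = FT ρ (h * (2 * π * w)) := by
  rw [Real.fourier_real_eq_integral_exp_smul, FT]
  have key := Measure.integral_comp_mul_left
    (fun y : ℝ => Complex.exp (-Complex.I * (h * (2 * π * w) : ℝ) * y) * (ρ y : ℂ)) h⁻¹
  rw [inv_inv, abs_of_pos hh] at key
  rw [← inv_smul_eq_iff₀ hh.ne', ← integral_smul] at key
  rw [← key]
  refine integral_congr_ae (ae_of_all _ fun x => ?_)
  simp only [Complex.real_smul, smul_eq_mul]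
  have : (-Complex.I * (h * (2 * π * w) : ℝ) * (h⁻¹ * x : ℝ)) =
      ((-2 * π * x * w : ℝ) : ℂ) * Complex.I := by
    have : (h : ℂ) ≠ 0 := by exact_mod_cast hh.ne'
    push_cast
    field_simp
  rw [this]
  push_cast
  ring

theorem gaussian_eq_fourierInv {v : ℝ} (hv : 0 < v) (x : ℝ) :
    (((√(2 * π * v))⁻¹ * Real.exp (-x ^ 2 / (2 * v)) : ℝ) : ℂ) =
      𝓕⁻ (fun w : ℝ => Complex.exp (-(v * (2 * π * w) ^ 2 / 2 : ℝ))) x := by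
  have hb : 0 < ((2 * π * v : ℝ) : ℂ).re := by rw [Complex.ofReal_re]; positivity
  have hF : (fun w : ℝ => Complex.exp (-(v * (2 * π * w) ^ 2 / 2 : ℝ))) =
      fun w : ℝ => Complex.exp (-π * (2 * π * v : ℝ) * w ^ 2) := by
    ext w; congr 1; push_cast; ring
  rw [hF, Real.fourierInv_eq_fourier_neg, fourier_gaussian_pi hb]
  have hsqrt : ((2 * π * v : ℝ) : ℂ) ^ (1 / 2 : ℂ) = (√(2 * π * v) : ℝ) := by
    rw [Real.sqrt_eq_rpow, Complex.ofReal_cpow (by positivity)]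
    push_cast
    rfl
  rw [hsqrt]
  push_cast
  rw [one_div]
  congr 2
  have : (π : ℂ) ≠ 0 := by exact_mod_cast pi_ne_zero
  have : (v : ℂ) ≠ 0 := by exact_mod_cast hv.ne'
  field_simp

theorem integrable_inv_one_add_mul_sq {c : ℝ} (hc : 0 < c) :
    Integrable fun w : ℝ => (1 + c * w ^ 2)⁻¹ := by
  have := integrable_inv_one_add_sq.comp_mul_left' (Real.sqrt_pos.2 hc).ne'
  simpa [mul_pow, Real.sq_sqrt hc.le] using this

theorem local_limit_theorem
    (ρ : ℝ → ℝ) (γ : ℝ) (σ : ℕ) (hσ : 1 ≤ σ)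
    (hInt : Integrable ρ)
    (hpos : ∀ᵐ x : ℝ, 0 ≤ ρ x)
    (hmass : ∫ x : ℝ, ρ x = 1)
    (hm1 : Integrable (fun x : ℝ => x * ρ x))
    (hmean : ∫ x : ℝ, x * ρ x = 0)
    (hm2 : Integrable (fun x : ℝ => x ^ 2 * ρ x))
    (hγ : γ = ∫ x : ℝ, x ^ 2 * ρ x) (hγpos : 0 < γ)
    (α C T : ℝ) (hα : 1 / (σ : ℝ) < α) (hC : 0 < C) (hT : 0 < T)
    (hdecay : ∀ t : ℝ, T < |t| → ‖FT ρ t‖ ≤ C * |t| ^ (-α)) :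
    TendstoUniformly
      (fun (N : ℕ) (x : ℝ) =>
        nConv (fun u : ℝ => (Real.sqrt ((σ : ℝ) / N))⁻¹ * ρ ((Real.sqrt ((σ : ℝ) / N))⁻¹ * u)) N x)
      (fun x : ℝ => (Real.sqrt (2 * π * σ * γ))⁻¹ * Real.exp (-x ^ 2 / (2 * σ * γ)))
      atTop := by
  set μ : Measure ℝ := volume.withDensity fun x => ENNReal.ofReal (ρ x)
  have : IsProbabilityMeasure μ := by
    constructor
    rw [withDensity_apply _ MeasurableSet.univ, Measure.restrict_univ,
      ← ofReal_integral_eq_lintegral_ofReal hInt hpos, hmass, ENNReal.ofReal_one]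
  have hmeanμ : ∫ x, x ∂μ = 0 := by
    rw [integral_withDensity_ofReal hInt hpos, ← hmean]
    simp_rw [smul_eq_mul, mul_comm]
  have hvarμ : ∫ x, x ^ 2 ∂μ = γ := by
    rw [integral_withDensity_ofReal hInt hpos, hγ]
    simp_rw [smul_eq_mul, mul_comm]
  have hL2 : MemLp id 2 μ := by
    rw [memLp_two_iff_integrable_sq (by fun_prop)]
    exact .of_integral_ne_zero (by simpa [hvarμ] using hγpos.ne')
  set φ : ℝ → ℂ := fun t => charFun μ (-t)
  have hFT (t : ℝ) : FT ρ t = φ t := FT_eq_charFun hInt hpos t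
  have hcont : Continuous φ := continuous_charFun.comp continuous_neg
  have hnorm (s : ℝ) : ‖φ s‖ ≤ 1 := norm_charFun_le_one _
  have htaylor : (fun t : ℝ => φ t - (1 - γ * t ^ 2 / 2)) =o[𝓝 0] fun t => t ^ 2 := by
    have h := (taylor_charFun_centered hL2 hmeanμ hvarμ).comp_tendsto
      (continuous_neg.tendsto' (0 : ℝ) 0 neg_zero)
    simpa only [Function.comp_def, Complex.ofReal_neg, neg_sq] using h
  have hσ0 : (0 : ℝ) < σ := by exact_mod_cast hσ
  obtain ⟨m, hm, c, hc, hb⟩ := exists_pow_le_inv_one_add_sq hcont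
    (fun s hs => norm_charFun_lt_one (withDensity_absolutelyContinuous _ _) (neg_ne_zero.2 hs))
    hγpos htaylor (lt_trans (by positivity) hα) fun s hs => hFT s ▸ hdecay s hs
  set h : ℕ → ℝ := fun N => √((σ : ℝ) / N)
  set F : ℕ → ℝ → ℂ := fun N w => φ (h N * (2 * π * w)) ^ N
  set G : ℝ → ℂ := fun w => Complex.exp (-((σ * γ) * (2 * π * w) ^ 2 / 2 : ℝ))
  have hhpos {N : ℕ} (hN : 0 < N) : 0 < h N := Real.sqrt_pos.2 (by positivity)
  have hint {a : ℝ} (ha : 0 < a) {k : ℕ} (hk : m ≤ k) :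
      Integrable fun w => φ (a * (2 * π * w)) ^ k := by
    refine (integrable_inv_one_add_mul_sq (c := c * (a * (2 * π)) ^ 2) (by positivity)).mono'
      (by fun_prop) (ae_of_all _ fun w => ?_)
    rw [norm_pow]
    refine ((pow_le_pow_of_le_one (norm_nonneg _) (hnorm _) hk).trans (hb _)).trans_eq ?_
    ring
  have hGint : Integrable G := by
    have h := integrable_exp_neg_mul_sq (b := σ * γ * (2 * π) ^ 2 / 2) (by positivity)
    refine h.ofReal.congr (ae_of_all _ fun w => ?_)
    refine (Complex.ofReal_exp _).trans (congrArg Complex.exp ?_)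
    push_cast
    ring
  have hlim : Tendsto (fun N => ∫ w, ‖F N w - G w‖) atTop (𝓝 0) := by
    rw [← integral_zero ℝ ℝ]
    refine tendsto_integral_filter_of_dominated_convergence
      (fun w => (1 + c * σ / (2 * m) * (2 * π) ^ 2 * w ^ 2)⁻¹ + ‖G w‖) ?_ ?_ ?_ ?_
    · exact Eventually.of_forall fun N => by fun_prop
    · filter_upwards [eventually_ge_atTop m] with N hN
      refine ae_of_all _ fun w => ?_
      rw [norm_norm]
      refine (norm_sub_le _ _).trans (add_le_add_left ?_ _)
      rw [norm_pow]
      refine (pow_scaled_le_inv_one_add_sq hnorm hm hc hb hσ0.le hN _).trans_eq ?_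
      ring
    · exact (integrable_inv_one_add_mul_sq (by positivity)).add hGint.norm
    · refine ae_of_all _ fun w => ?_
      have h := ((tendsto_pow_of_taylor htaylor hσ0.le (2 * π * w)).sub_const (G w)).norm
      rwa [sub_self, norm_zero] at h
  rw [Metric.tendstoUniformly_iff]
  intro ε hε
  filter_upwards [hlim.eventually_lt_const hε, eventually_ge_atTop (m + 1)] with N hN hmN x
  obtain ⟨n, rfl⟩ : ∃ n, N = n + 2 := ⟨N - 2, by omega⟩
  have hpos' := hhpos (N := n + 2) (by omega)
  have hfourier : 𝓕 (fun u => (((h (n + 2))⁻¹ * ρ ((h (n + 2))⁻¹ * u) : ℝ) : ℂ)) =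
      fun w => φ (h (n + 2) * (2 * π * w)) := by
    ext w
    rw [fourier_scaled_eq_FT ρ hpos', hFT]
  have hΦ := nConv_eq_fourierInv ((hInt.comp_mul_left' (inv_ne_zero hpos'.ne')).const_mul _) n
    (by rw [hfourier]; exact hint hpos' (by omega))
    (by rw [hfourier]; exact hint hpos' (by omega)) x
  rw [hfourier] at hΦ
  have hgauss := gaussian_eq_fourierInv (v := σ * γ) (by positivity) x
  rw [← mul_assoc, ← mul_assoc] at hgauss
  rw [dist_comm, Real.dist_eq, ← Real.norm_eq_abs, ← Complex.norm_real, Complex.ofReal_sub]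
  refine lt_of_le_of_lt ?_ hN
  refine le_trans (le_of_eq ?_) (norm_fourierInv_sub_le (hint hpos' (by omega)) hGint x)
  rw [hgauss, ← hΦ]
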